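/- arXiv:1709.00596 — 9 statements merged into one kernel-verified Lean document; each statement's English description precedes it below -/
import Mathlib

section
/- Let Ψ be a planar-monotone-style CNF instance with n variables and m clauses such that every clause set L_h is nonempty, and let G_Ψ be the associated domination graph. Then G_Ψ has a dominating set of cardinality n if and only if Ψ is satisfiable. -/
/-- A planar-monotone-style CNF instance with `n` variables and `m` clauses:
clause `h` consists of the set of variable indices `L h` together with a sign
`eps h` (`true` = all literals unnegated, `false` = all negated). -/
structure PMCnf (n m : ℕ) where
  L : Fin m → Finset (Fin n)
  eps : Fin m → Bool

/-- An assignment `a` satisfies `Ψ` if every clause contains a variable whose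
value agrees with the sign of the clause. -/
def PMCnf.Satisfies {n m : ℕ} (Ψ : PMCnf n m) (a : Fin n → Bool) : Prop :=
  ∀ h : Fin m, ∃ i ∈ Ψ.L h, a i = Ψ.eps h

/-- The closed neighborhood `Γ(S)` of a set of vertices. -/
def closedNbhd {V : Type*} (G : SimpleGraph V) (S : Set V) : Set V :=
  S ∪ {v | ∃ s ∈ S, G.Adj v s}

/-- `S` is a dominating set if `Γ(S) = V`. -/
def IsDominating {V : Type*} (G : SimpleGraph V) (S : Set V) : Prop :=
  closedNbhd G S = Set.univ

/-- Vertices of the domination graph `G_Ψ`: for each variable `i` the four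
vertices `v_i = (i,0)`, `v̄_i = (i,1)`, `u_i = (i,2)`, `w_i = (i,3)`, and for
each clause `h` a vertex `z_h`. -/
abbrev DomVert (n m : ℕ) := (Fin n × Fin 4) ⊕ Fin m

/-- The base relation generating the edges of `G_Ψ`: the four vertices of each
variable gadget are pairwise adjacent, and `z_h` is adjacent to `v_i`
(resp. `v̄_i`) for each `i ∈ L h` when `eps h` is `true` (resp. `false`). -/
def domRel {n m : ℕ} (Ψ : PMCnf n m) : DomVert n m → DomVert n m → Prop
  | Sum.inl (i, _), Sum.inl (j, _) => i = j
  | Sum.inl (i, a), Sum.inr h => i ∈ Ψ.L h ∧ a = (if Ψ.eps h then 0 else 1)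
  | Sum.inr h, Sum.inl (i, a) => i ∈ Ψ.L h ∧ a = (if Ψ.eps h then 0 else 1)
  | Sum.inr _, Sum.inr _ => False

/-- The domination graph `G_Ψ` associated to the CNF instance `Ψ`. -/
def domGraph {n m : ℕ} (Ψ : PMCnf n m) : SimpleGraph (DomVert n m) :=
  SimpleGraph.fromRel (domRel Ψ)

theorem mem_closedNbhd {V : Type*} {G : SimpleGraph V} {S : Set V} {v : V} :
    v ∈ closedNbhd G S ↔ v ∈ S ∨ ∃ s ∈ S, G.Adj v s :=
  Iff.rfl

theorem domGraph_adj_inl_inl {n m : ℕ} (Ψ : PMCnf n m) (i j : Fin n) (b c : Fin 4) :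
    (domGraph Ψ).Adj (Sum.inl (i, b)) (Sum.inl (j, c)) ↔ i = j ∧ b ≠ c := by
  simp only [domGraph, SimpleGraph.fromRel_adj, domRel]
  grind

theorem domGraph_adj_inr_inl {n m : ℕ} (Ψ : PMCnf n m) (h : Fin m) (i : Fin n) (b : Fin 4) :
    (domGraph Ψ).Adj (Sum.inr h) (Sum.inl (i, b)) ↔
      i ∈ Ψ.L h ∧ b = if Ψ.eps h then 0 else 1 := by
  simp [domGraph, domRel]

/-- The set of vertices choosing exactly the vertex `f i` from the gadget of each variable `i`. -/
def gadgetSection {n : ℕ} (m : ℕ) (f : Fin n → Fin 4) : Set (DomVert n m) :=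
  Set.range fun i => Sum.inl (i, f i)

theorem ncard_gadgetSection {n m : ℕ} (f : Fin n → Fin 4) :
    (gadgetSection m f).ncard = n := by
  have hinj : Function.Injective fun i => (Sum.inl (i, f i) : DomVert n m) := fun i j hij =>
    congrArg Prod.fst (Sum.inl_injective hij)
  rw [gadgetSection, ← Set.image_univ, Set.ncard_image_of_injective _ hinj, Set.ncard_univ,
    Nat.card_eq_fintype_card, Fintype.card_fin]

/-- A dominating set meets every gadget, since `u_i` has no neighbors outside its gadget. -/
theorem IsDominating.exists_mem_gadget {n m : ℕ} {Ψ : PMCnf n m} {S : Set (DomVert n m)}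
    (hS : IsDominating (domGraph Ψ) S) (i : Fin n) : ∃ b, Sum.inl (i, b) ∈ S := by
  have hu : (Sum.inl (i, 2) : DomVert n m) ∈ closedNbhd (domGraph Ψ) S := hS ▸ Set.mem_univ _
  rcases mem_closedNbhd.1 hu with hmem | ⟨⟨j, b⟩ | h, hs, hadj⟩
  · exact ⟨2, hmem⟩
  · obtain ⟨rfl, -⟩ := (domGraph_adj_inl_inl Ψ _ _ _ _).1 hadj
    exact ⟨b, hs⟩
  · have hb := ((domGraph_adj_inr_inl Ψ _ _ _).1 hadj.symm).2
    split_ifs at hb <;> exact absurd hb (by decide)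

/-- A dominating set of cardinality `n` contains exactly one vertex of each gadget and no clause
vertex. -/
theorem IsDominating.exists_eq_gadgetSection {n m : ℕ} {Ψ : PMCnf n m} {S : Set (DomVert n m)}
    (hS : IsDominating (domGraph Ψ) S) (hcard : S.ncard = n) :
    ∃ f : Fin n → Fin 4, S = gadgetSection m f := by
  choose f hf using hS.exists_mem_gadget
  refine ⟨f, (Set.eq_of_subset_of_ncard_le (Set.range_subset_iff.2 hf) ?_ S.toFinite).symm⟩
  exact (hcard.trans (ncard_gadgetSection f).symm).le

theorem isDominating_gadgetSection_iff {n m : ℕ} (Ψ : PMCnf n m) (f : Fin n → Fin 4) :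
    IsDominating (domGraph Ψ) (gadgetSection m f) ↔
      ∀ h, ∃ i ∈ Ψ.L h, f i = if Ψ.eps h then 0 else 1 := by
  rw [IsDominating, Set.eq_univ_iff_forall]
  simp only [mem_closedNbhd, gadgetSection, Set.exists_range_iff, Sum.forall, Prod.forall,
    domGraph_adj_inl_inl, domGraph_adj_inr_inl]
  constructor
  · rintro ⟨-, hz⟩ h
    simpa using hz h
  · refine fun hsat => ⟨fun i b => ?_, fun h => Or.inr (hsat h)⟩
    by_cases hb : b = f i
    · exact Or.inl ⟨i, by rw [hb]⟩
    · exact Or.inr ⟨i, rfl, hb⟩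

/-- If every clause of `Ψ` is nonempty, then `G_Ψ` has a
dominating set of cardinality `n` iff `Ψ` is satisfiable. -/
theorem domGraph_dominating_card_iff_satisfiable {n m : ℕ} (Ψ : PMCnf n m)
    (hne : ∀ h : Fin m, (Ψ.L h).Nonempty) :
    (∃ S : Set (DomVert n m), IsDominating (domGraph Ψ) S ∧ S.ncard = n) ↔
      ∃ a : Fin n → Bool, Ψ.Satisfies a := by
  constructor
  · rintro ⟨S, hS, hcard⟩
    obtain ⟨f, rfl⟩ := hS.exists_eq_gadgetSection hcard
    refine ⟨fun i => decide (f i = 0), fun h => ?_⟩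
    obtain ⟨i, hi, hfi⟩ := (isDominating_gadgetSection_iff Ψ f).1 hS h
    exact ⟨i, hi, by cases he : Ψ.eps h <;> simp [hfi, he]⟩
  · rintro ⟨a, ha⟩
    refine ⟨gadgetSection m fun i => if a i then 0 else 1,
      (isDominating_gadgetSection_iff Ψ _).2 fun h => ?_, ncard_gadgetSection _⟩
    obtain ⟨i, hi, hai⟩ := ha h
    exact ⟨i, hi, by rw [hai]⟩
end

section
/- Let Ψ be a planar-monotone-style CNF instance with n variables and m clauses, and let G_Ψ be the associated domination graph. Then every dominating set of G_Ψ has cardinality at least n. -/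
/-- A dominating set of `G_Ψ` meets every variable gadget. -/
theorem IsDominating.exists_inl_mem {n m : ℕ} {Ψ : PMCnf n m} {S : Set (DomVert n m)}
    (hS : IsDominating (domGraph Ψ) S) (i : Fin n) : ∃ a : Fin 4, Sum.inl (i, a) ∈ S := by
  have hu : (Sum.inl (i, 2) : DomVert n m) ∈ closedNbhd (domGraph Ψ) S := by
    rw [show closedNbhd (domGraph Ψ) S = Set.univ from hS]
    exact Set.mem_univ _
  rcases hu with hu | ⟨⟨j, a⟩ | h, hs, hadj⟩
  · exact ⟨2, hu⟩
  · obtain rfl : i = j := by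
      rcases hadj.2 with h | h
      · exact h
      · exact Eq.symm h
    exact ⟨a, hs⟩
  · have h2 : (2 : Fin 4) = if Ψ.eps h then 0 else 1 := by
      rcases hadj.2 with h | h
      · exact h.2
      · exact h.2
    split_ifs at h2 <;> exact absurd h2 (by decide)

/-- Every dominating set of `G_Ψ` has cardinality at least `n`. -/
theorem domGraph_dominating_card_ge {n m : ℕ} (Ψ : PMCnf n m)
    (S : Set (DomVert n m)) (hS : IsDominating (domGraph Ψ) S) :
    n ≤ S.ncard := by
  choose a ha using hS.exists_inl_mem
  have hinj : Function.Injective fun i => (Sum.inl (i, a i) : DomVert n m) := fun i j hij =>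
    congrArg Prod.fst (Sum.inl_injective hij)
  calc n = (Set.range fun i => (Sum.inl (i, a i) : DomVert n m)).ncard := by
        rw [Set.ncard_range_of_injective hinj, Nat.card_fin]
    _ ≤ S.ncard := Set.ncard_le_ncard (Set.range_subset_iff.2 ha) S.toFinite
end

section
/- Let Ψ be a planar-monotone-style CNF instance with n variables and m clauses, and let G_Ψ be the associated domination graph. If an assignment a : Fin n → Bool satisfies Ψ, then the set S = {v_i : a i = true} ∪ {v̄_i : a i = false} is a dominating set of G_Ψ of cardinality n. -/
/-- If `a` satisfies `Ψ`, then `S = {v_i : a i = true} ∪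
{v̄_i : a i = false}` is a dominating set of `G_Ψ` of cardinality `n`. -/
theorem domGraph_dominating_of_satisfies {n m : ℕ} (Ψ : PMCnf n m)
    (a : Fin n → Bool) (ha : Ψ.Satisfies a) (S : Set (DomVert n m))
    (hS : S = Set.range fun i : Fin n =>
      (Sum.inl (i, if a i then 0 else 1) : DomVert n m)) :
    IsDominating (domGraph Ψ) S ∧ S.ncard = n := by
  subst hS
  refine ⟨Set.eq_univ_of_forall ?_, ?_⟩
  · rintro (⟨i, k⟩ | h)
    · by_cases hk : k = if a i then 0 else 1
      · exact Or.inl ⟨i, by rw [hk]⟩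
      · refine Or.inr ⟨_, ⟨i, rfl⟩, ?_⟩
        simp [domGraph, domRel, hk]
    · obtain ⟨i, hi, hai⟩ := ha h
      refine Or.inr ⟨_, ⟨i, rfl⟩, ?_⟩
      simp [domGraph, domRel, hi, hai]
  · rw [← Set.image_univ, Set.ncard_image_of_injective, Set.ncard_univ, Nat.card_fin]
    intro i j hij
    exact congrArg Prod.fst (Sum.inl_injective hij)
end

section
/- Let G be a finite simple graph with vertex set V, let S, T ⊆ V, and suppose that: (i) no vertex of S lies in T or is adjacent to a vertex of T (i.e., S ∩ N[T] = ∅), and (ii) every vertex v ∉ T that is adjacent to some vertex of T has at least two neighbors in T. Then for every k ∈ ℕ, Γ₁^[k](Γ(S)) ∩ T = ∅. In particular, if T is nonempty then S is not a power dominating set of G. -/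
/-- `S₁(A)`: the vertices of `A` having exactly one neighbor outside `A`. -/
def pdS1 {V : Type*} (G : SimpleGraph V) (A : Set V) : Set V :=
  {s ∈ A | ∃! v, v ∉ A ∧ G.Adj s v}

/-- The propagation operator `Γ₁(A) = A ∪ Γ(S₁(A))`. -/
def pdStep {V : Type*} (G : SimpleGraph V) (A : Set V) : Set V :=
  A ∪ closedNbhd G (pdS1 G A)

/-- `S` is a power dominating set if iterating `Γ₁` starting from `Γ(S)`
eventually covers all vertices. -/
def IsPowerDominating {V : Type*} (G : SimpleGraph V) (S : Set V) : Prop :=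
  ∃ k : ℕ, (pdStep G)^[k] (closedNbhd G S) = Set.univ

theorem closedNbhd_disjoint_symm {V : Type*} (G : SimpleGraph V) {S T : Set V}
    (h : Disjoint S (closedNbhd G T)) : Disjoint (closedNbhd G S) T := by
  rw [Set.disjoint_left] at h ⊢
  rintro v (hv | ⟨s, hs, hvs⟩) hvT
  · exact h hv (Or.inl hvT)
  · exact h hs (Or.inr ⟨v, hvT, hvs.symm⟩)

theorem pdStep_disjoint {V : Type*} (G : SimpleGraph V) {A T : Set V}
    (hT : ∀ v ∉ T, (∃ t ∈ T, G.Adj v t) → 2 ≤ (G.neighborSet v ∩ T).ncard)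
    (hA : Disjoint A T) : Disjoint (pdStep G A) T := by
  rw [Set.disjoint_left] at hA
  refine Set.disjoint_union_left.2 ⟨Set.disjoint_left.2 hA, Set.disjoint_left.2 ?_⟩
  rintro v (hv | ⟨s, ⟨hsA, w, -, hw⟩, hvs⟩) hvT
  · exact hA hv.1 hvT
  · have hcard : 1 < (G.neighborSet s ∩ T).ncard := hT s (hA hsA) ⟨v, hvT, hvs.symm⟩
    obtain ⟨a, ha, b, hb, hab⟩ := (Set.one_lt_ncard_iff_nontrivial_and_finite.1 hcard).1
    have eq_w : ∀ x ∈ G.neighborSet s ∩ T, x = w := fun x hx =>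
      hw x ⟨fun hxA => hA hxA hx.2, hx.1⟩
    exact hab ((eq_w a ha).trans (eq_w b hb).symm)

/-- If `S` is disjoint from the closed neighborhood of `T` and
every vertex outside `T` with a neighbor in `T` has at least two neighbors in
`T`, then the power domination process started from `S` never reaches `T`; in
particular if `T` is nonempty then `S` is not a power dominating set. -/
theorem not_powerDominating_of_blocked {V : Type*} [Fintype V]
    (G : SimpleGraph V) (S T : Set V)
    (h1 : S ∩ closedNbhd G T = ∅)
    (h2 : ∀ v ∉ T, (∃ t ∈ T, G.Adj v t) → 2 ≤ (G.neighborSet v ∩ T).ncard) :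
    (∀ k : ℕ, (pdStep G)^[k] (closedNbhd G S) ∩ T = ∅) ∧
      (T.Nonempty → ¬ IsPowerDominating G S) := by
  have blocked (k : ℕ) : Disjoint ((pdStep G)^[k] (closedNbhd G S)) T := by
    induction k with
    | zero => exact closedNbhd_disjoint_symm G (Set.disjoint_iff_inter_eq_empty.2 h1)
    | succ k ih =>
      rw [Function.iterate_succ_apply']
      exact pdStep_disjoint G h2 ih
  refine ⟨fun k => (blocked k).inter_eq, ?_⟩
  rintro ⟨t, ht⟩ ⟨k, hk⟩
  exact Set.disjoint_left.1 (blocked k) (hk ▸ Set.mem_univ t) ht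
end

section
/- Let Ψ be a planar-monotone-style CNF instance with n variables in which every clause has |L_h| ∈ {2,3}, let G'_Ψ be the associated power-domination graph, and let S be any set of vertices of G'_Ψ. If for some variable i the set S contains at least one of v_i, v̄_i, u_i, then all six vertices v_i, v̄_i, u_i, v'_i, v̄'_i, u'_i belong to Γ₁(Γ(S)). -/
/-- Validity predicate for clause-gadget vertices of `G'_Ψ`: `(h, Sum.inl l)`
is the vertex `z_{h,l}` (requires `l ∈ L h`), and `(h, Sum.inr 0)`,
`(h, Sum.inr 1)` are the vertices `z_{h,h}`, `v_{h,h}` (present only when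
clause `h` has exactly two literals). -/
def ClauseOk {n m : ℕ} (Ψ : PMCnf n m) : Fin m × (Fin n ⊕ Fin 2) → Prop
  | (h, Sum.inl l) => l ∈ Ψ.L h
  | (h, Sum.inr _) => (Ψ.L h).card = 2

/-- Vertices of the power-domination graph `G'_Ψ`: for each variable `i` the
six vertices `v_i = (i,0)`, `v̄_i = (i,1)`, `u_i = (i,2)`, `v'_i = (i,3)`,
`v̄'_i = (i,4)`, `u'_i = (i,5)`, together with the clause-gadget vertices. -/
abbrev PVert {n m : ℕ} (Ψ : PMCnf n m) :=
  (Fin n × Fin 6) ⊕ {p : Fin m × (Fin n ⊕ Fin 2) // ClauseOk Ψ p}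

/-- The base relation generating the edges of `G'_Ψ`.
* Within a variable gadget, `(i,a)` and `(i,b)` are adjacent iff
  `a ≢ b (mod 3)`, i.e. all pairs except `(v_i,v'_i)`, `(v̄_i,v̄'_i)`,
  `(u_i,u'_i)` (and loops) are edges.
* A clause-gadget vertex of clause `h` with slot `q` is adjacent to the
  literal vertex `w_i` (`= v_i` or `v̄_i` according to `eps h`) for each
  `i ∈ L h`, except that `z_{h,l}` is not adjacent to `w_l` itself.
* Two clause-gadget vertices are adjacent iff they belong to the same clause,
  are distinct, and are not the pair `(z_{h,h}, v_{h,h})`. -/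
def pdRel {n m : ℕ} (Ψ : PMCnf n m) : PVert Ψ → PVert Ψ → Prop
  | Sum.inl (i, a), Sum.inl (j, b) => i = j ∧ a.val % 3 ≠ b.val % 3
  | Sum.inl (i, a), Sum.inr ⟨(h, q), _⟩ =>
      a = (if Ψ.eps h then 0 else 1) ∧ i ∈ Ψ.L h ∧ ∀ l, q = Sum.inl l → l ≠ i
  | Sum.inr ⟨(h, q), _⟩, Sum.inl (i, a) =>
      a = (if Ψ.eps h then 0 else 1) ∧ i ∈ Ψ.L h ∧ ∀ l, q = Sum.inl l → l ≠ i
  | Sum.inr ⟨(h, q), _⟩, Sum.inr ⟨(h', q'), _⟩ =>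
      h = h' ∧ q ≠ q' ∧ (q.isLeft = true ∨ q'.isLeft = true)

/-- The power-domination graph `G'_Ψ` associated to the CNF instance `Ψ`. -/
def pdGraph {n m : ℕ} (Ψ : PMCnf n m) : SimpleGraph (PVert Ψ) :=
  SimpleGraph.fromRel (pdRel Ψ)

/-- The literal vertex `w_l` of clause `h`: `v_l` if `eps h = true`,
`v̄_l` if `eps h = false`. -/
def wV {n m : ℕ} (Ψ : PMCnf n m) (h : Fin m) (l : Fin n) : PVert Ψ :=
  Sum.inl (l, if Ψ.eps h then 0 else 1)

/-- The clause-gadget vertex `z_{h,l}` (for `l ∈ L h`). -/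
def zV {n m : ℕ} (Ψ : PMCnf n m) (h : Fin m) (l : Fin n) (hl : l ∈ Ψ.L h) :
    PVert Ψ :=
  Sum.inr ⟨(h, Sum.inl l), hl⟩

/-- The clause-gadget vertex `z_{h,h}` (for a clause with two literals). -/
def zhhV {n m : ℕ} (Ψ : PMCnf n m) (h : Fin m) (hc : (Ψ.L h).card = 2) :
    PVert Ψ :=
  Sum.inr ⟨(h, Sum.inr 0), hc⟩

/-- The clause-gadget vertex `v_{h,h}` (for a clause with two literals). -/
def vhhV {n m : ℕ} (Ψ : PMCnf n m) (h : Fin m) (hc : (Ψ.L h).card = 2) :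
    PVert Ψ :=
  Sum.inr ⟨(h, Sum.inr 1), hc⟩

theorem pdGraph_adj_inl_inl {n m : ℕ} (Ψ : PMCnf n m) (i j : Fin n) (a b : Fin 6) :
    (pdGraph Ψ).Adj (Sum.inl (i, a)) (Sum.inl (j, b)) ↔ i = j ∧ a.val % 3 ≠ b.val % 3 := by
  simp only [pdGraph, SimpleGraph.fromRel_adj, pdRel]
  grind

/-- The vertices `u_i, v'_i, v̄'_i, u'_i` have no neighbors in the clause gadgets. -/
theorem not_pdGraph_adj_inl_inr {n m : ℕ} (Ψ : PMCnf n m) (i : Fin n) {p : Fin 6}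
    (hp : 2 ≤ p.val) (q : {p : Fin m × (Fin n ⊕ Fin 2) // ClauseOk Ψ p}) :
    ¬ (pdGraph Ψ).Adj (Sum.inl (i, p)) (Sum.inr q) := by
  obtain ⟨⟨h, r⟩, hq⟩ := q
  simp only [pdGraph, SimpleGraph.fromRel_adj, pdRel]
  rintro ⟨-, ⟨rfl, -⟩ | ⟨rfl, -⟩⟩ <;> revert hp <;> split <;> simp

/-- If `(i, a) ∈ S`, then the gadget vertex `(i, p)`, having no neighbors in the clause gadgets
and being adjacent to `(i, a)`, propagates to the remaining vertex of the gadget. -/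
theorem inl_mem_pdStep_of_mem {n m : ℕ} (Ψ : PMCnf n m) (S : Set (PVert Ψ)) (i : Fin n)
    (a p : Fin 6) (ha : (Sum.inl (i, a) : PVert Ψ) ∈ S) (hp : 2 ≤ p.val)
    (hap : p.val % 3 ≠ a.val % 3) (c : Fin 6) :
    (Sum.inl (i, c) : PVert Ψ) ∈ pdStep (pdGraph Ψ) (closedNbhd (pdGraph Ψ) S) := by
  have hA : ∀ b : Fin 6, b.val % 3 ≠ a.val % 3 →
      (Sum.inl (i, b) : PVert Ψ) ∈ closedNbhd (pdGraph Ψ) S := fun b hb =>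
    Or.inr ⟨_, ha, (pdGraph_adj_inl_inl Ψ i i b a).2 ⟨rfl, hb⟩⟩
  have haA : (Sum.inl (i, a) : PVert Ψ) ∈ closedNbhd (pdGraph Ψ) S := Or.inl ha
  by_cases hc : (Sum.inl (i, c) : PVert Ψ) ∈ closedNbhd (pdGraph Ψ) S
  · exact Or.inl hc
  have hca : c.val % 3 = a.val % 3 := by
    by_contra h
    exact hc (hA c h)
  refine Or.inr (Or.inr ⟨Sum.inl (i, p), ⟨hA p hap, Sum.inl (i, c), ⟨hc, ?_⟩, ?_⟩, ?_⟩)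
  · exact (pdGraph_adj_inl_inl Ψ i i p c).2 ⟨rfl, by omega⟩
  · rintro (⟨j, b⟩ | q) ⟨hb, hadj⟩
    · obtain ⟨rfl, -⟩ := (pdGraph_adj_inl_inl Ψ i j p b).1 hadj
      have hba : b.val % 3 = a.val % 3 := by
        by_contra h
        exact hb (hA b h)
      have hne : ∀ d : Fin 6, (Sum.inl (i, d) : PVert Ψ) ∉ closedNbhd (pdGraph Ψ) S →
          d.val ≠ a.val := fun d hd h => hd (Fin.ext h ▸ haA)
      have hb' := hne b hb
      have hc' := hne c hc
      have : b = c := Fin.ext (by omega)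
      rw [this]
    · exact absurd hadj (not_pdGraph_adj_inl_inr Ψ i hp q)
  · exact (pdGraph_adj_inl_inl Ψ i i c p).2 ⟨rfl, by omega⟩

/-- If `S` contains one of `v_i, v̄_i, u_i`, then all six
vertices of the variable gadget of `i` belong to `Γ₁(Γ(S))`. -/
theorem pdGraph_gadget_subset_step {n m : ℕ} (Ψ : PMCnf n m)
    (hsz : ∀ h : Fin m, (Ψ.L h).card = 2 ∨ (Ψ.L h).card = 3)
    (S : Set (PVert Ψ)) (i : Fin n)
    (hi : (Sum.inl (i, 0) : PVert Ψ) ∈ S ∨ (Sum.inl (i, 1) : PVert Ψ) ∈ S ∨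
      (Sum.inl (i, 2) : PVert Ψ) ∈ S) :
    ∀ c : Fin 6,
      (Sum.inl (i, c) : PVert Ψ) ∈
        pdStep (pdGraph Ψ) (closedNbhd (pdGraph Ψ) S) := by
  rcases hi with h | h | h
  · exact inl_mem_pdStep_of_mem Ψ S i 0 2 h (by decide) (by decide)
  · exact inl_mem_pdStep_of_mem Ψ S i 1 2 h (by decide) (by decide)
  · exact inl_mem_pdStep_of_mem Ψ S i 2 3 h (by decide) (by decide)
end

section
/- Let Ψ be a planar-monotone-style CNF instance with n variables in which every clause has |L_h| ∈ {2,3}, and let G'_Ψ be the associated power-domination graph. If an assignment a : Fin n → Bool satisfies Ψ and S = {v_i : a i = true} ∪ {v̄_i : a i = false}, then S has cardinality n and Γ₁(Γ(S)) equals the full vertex set of G'_Ψ; in particular S is a power dominating set. -/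
/-- A vertex adjacent to some `s ∈ A`, all of whose neighbors outside `A` equal that vertex,
lies in `Γ₁(A)`. -/
theorem mem_pdStep_of_adj {V : Type*} {G : SimpleGraph V} {A : Set V} {x s : V}
    (hs : s ∈ A) (hsx : G.Adj s x) (huniq : ∀ v, v ∉ A → G.Adj s v → v = x) :
    x ∈ pdStep G A := by
  by_cases hx : x ∈ A
  · exact Or.inl hx
  · exact Or.inr (Or.inr ⟨s, ⟨hs, x, ⟨hx, hsx⟩, fun v hv => huniq v hv.1 hv.2⟩, hsx.symm⟩)

section pdGraph

variable {n m : ℕ} (Ψ : PMCnf n m)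

theorem pdRel_symm {x y : PVert Ψ} (hxy : pdRel Ψ x y) : pdRel Ψ y x := by
  rcases x with ⟨i, b⟩ | ⟨⟨h, q⟩, hq⟩ <;> rcases y with ⟨j, c⟩ | ⟨⟨k, r⟩, hr⟩
  · exact ⟨hxy.1.symm, hxy.2.symm⟩
  · exact hxy
  · exact hxy
  · exact ⟨hxy.1.symm, hxy.2.1.symm, hxy.2.2.symm⟩

theorem pdRel_irrefl (x : PVert Ψ) : ¬ pdRel Ψ x x := by
  rcases x with ⟨i, b⟩ | ⟨⟨h, q⟩, hq⟩
  · exact fun hx => hx.2 rfl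
  · exact fun hx => hx.2.1 rfl

theorem pdGraph_adj_iff {x y : PVert Ψ} : (pdGraph Ψ).Adj x y ↔ pdRel Ψ x y := by
  refine (SimpleGraph.fromRel_adj _ _ _).trans ⟨?_, fun hxy => ⟨?_, Or.inl hxy⟩⟩
  · rintro ⟨-, hxy | hxy⟩
    exacts [hxy, pdRel_symm Ψ hxy]
  · rintro rfl
    exact pdRel_irrefl Ψ x hxy

/-- The literal vertices made true by the assignment `a`. -/
def trueLiterals (a : Fin n → Bool) : Set (PVert Ψ) :=
  Set.range fun i : Fin n => (Sum.inl (i, if a i then 0 else 1) : PVert Ψ)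

theorem ncard_trueLiterals (a : Fin n → Bool) : (trueLiterals Ψ a).ncard = n := by
  rw [trueLiterals, Set.ncard_range_of_injective, Nat.card_fin]
  intro i j hij
  exact congrArg Prod.fst (Sum.inl.inj hij)

/-- In the gadget of variable `i`, only the twin of the true literal can be undominated. -/
theorem eq_of_inl_notMem_closedNbhd (a : Fin n → Bool) {i : Fin n} {b : Fin 6}
    (hx : (Sum.inl (i, b) : PVert Ψ) ∉ closedNbhd (pdGraph Ψ) (trueLiterals Ψ a)) :
    b = if a i then 3 else 4 := by
  by_contra hb
  refine hx ?_
  clear hx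
  by_cases hc : b = if a i then 0 else 1
  · exact Or.inl ⟨i, by rw [hc]⟩
  · refine Or.inr ⟨_, ⟨i, rfl⟩, (pdGraph_adj_iff Ψ).2 ⟨rfl, ?_⟩⟩
    revert hb hc
    generalize a i = t
    revert b t
    decide

/-- In the gadget of clause `h` with true literal `w_i`, only `z_{h,i}` can be undominated. -/
theorem eq_of_inr_notMem_closedNbhd (a : Fin n → Bool) {h : Fin m} {q : Fin n ⊕ Fin 2}
    {hq : ClauseOk Ψ (h, q)} {i : Fin n} (hi : i ∈ Ψ.L h) (hai : a i = Ψ.eps h)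
    (hx : (Sum.inr ⟨(h, q), hq⟩ : PVert Ψ) ∉ closedNbhd (pdGraph Ψ) (trueLiterals Ψ a)) :
    q = Sum.inl i := by
  by_contra hne
  refine hx (Or.inr ⟨_, ⟨i, rfl⟩, (pdGraph_adj_iff Ψ).2 ⟨by rw [hai], hi, ?_⟩⟩)
  rintro l rfl rfl
  exact hne rfl

theorem pdStep_closedNbhd_trueLiterals (hsz : ∀ h : Fin m, 1 < (Ψ.L h).card)
    (a : Fin n → Bool) (ha : Ψ.Satisfies a) :
    pdStep (pdGraph Ψ) (closedNbhd (pdGraph Ψ) (trueLiterals Ψ a)) = Set.univ := by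
  refine Set.eq_univ_of_forall fun x => ?_
  by_cases hx : x ∈ closedNbhd (pdGraph Ψ) (trueLiterals Ψ a)
  · exact Or.inl hx
  rcases x with ⟨i, b⟩ | ⟨⟨h, q⟩, hq⟩
  · have hb := eq_of_inl_notMem_closedNbhd Ψ a hx
    refine mem_pdStep_of_adj (s := Sum.inl (i, 5)) ?_ ((pdGraph_adj_iff Ψ).2 ⟨rfl, ?_⟩) ?_
    · by_contra h5
      have h5' := eq_of_inl_notMem_closedNbhd Ψ a h5
      split_ifs at h5' <;> simp at h5'
    · rw [hb]
      split_ifs <;> decide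
    · rintro (⟨j, c⟩ | ⟨⟨k, r⟩, hr⟩) hv hadj
      · obtain ⟨rfl, -⟩ := (pdGraph_adj_iff Ψ).1 hadj
        rw [eq_of_inl_notMem_closedNbhd Ψ a hv, hb]
      · have h5 := ((pdGraph_adj_iff Ψ).1 hadj).1
        split_ifs at h5 <;> simp at h5
  · obtain ⟨i, hi, hai⟩ := ha h
    obtain rfl := eq_of_inr_notMem_closedNbhd Ψ a hi hai hx
    obtain ⟨j, hj, hji⟩ := Finset.exists_mem_ne (hsz h) i
    refine mem_pdStep_of_adj (s := zV Ψ h j hj) ?_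
      ((pdGraph_adj_iff Ψ).2 ⟨rfl, by simpa using hji, Or.inl rfl⟩) ?_
    · by_contra hz
      exact hji (Sum.inl.inj (eq_of_inr_notMem_closedNbhd Ψ a hi hai hz))
    · rintro (⟨k, c⟩ | ⟨⟨k, r⟩, hr⟩) hv hadj
      · have hc := ((pdGraph_adj_iff Ψ).1 hadj).1
        rw [eq_of_inl_notMem_closedNbhd Ψ a hv] at hc
        split_ifs at hc <;> simp at hc
      · obtain ⟨rfl, -⟩ := (pdGraph_adj_iff Ψ).1 hadj
        obtain rfl := eq_of_inr_notMem_closedNbhd Ψ a hi hai hv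
        rfl

end pdGraph

/-- If `a` satisfies `Ψ` and `S = {v_i : a i = true} ∪
{v̄_i : a i = false}`, then `|S| = n` and `Γ₁(Γ(S))` is the full vertex set;
in particular `S` is a power dominating set. -/
theorem pdGraph_powerDominating_of_satisfies {n m : ℕ} (Ψ : PMCnf n m)
    (hsz : ∀ h : Fin m, (Ψ.L h).card = 2 ∨ (Ψ.L h).card = 3)
    (a : Fin n → Bool) (ha : Ψ.Satisfies a) (S : Set (PVert Ψ))
    (hS : S = Set.range fun i : Fin n =>
      (Sum.inl (i, if a i then 0 else 1) : PVert Ψ)) :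
    S.ncard = n ∧
      pdStep (pdGraph Ψ) (closedNbhd (pdGraph Ψ) S) = Set.univ ∧
      IsPowerDominating (pdGraph Ψ) S := by
  subst hS
  have hstep := pdStep_closedNbhd_trueLiterals Ψ
    (fun h => by rcases hsz h with h2 | h3 <;> omega) a ha
  exact ⟨ncard_trueLiterals Ψ a, hstep, 1, hstep⟩
end

section
/- Let Ψ be a planar-monotone-style CNF instance with n variables in which every clause has |L_h| ∈ {2,3}, and let G'_Ψ be the associated power-domination graph. If S is a power dominating set of G'_Ψ, then for every variable i the set S contains at least one of the six vertices v_i, v̄_i, u_i, v'_i, v̄'_i, u'_i. -/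
/-- Only the vertices of gadget `i` are adjacent to a non-literal vertex `(i, c)`, `c ≥ 2`. -/
lemma pdGraph_adj_nonliteral {n m : ℕ} {Ψ : PMCnf n m} {i : Fin n} {c : Fin 6} (hc : 2 ≤ c)
    {s : PVert Ψ} (hs : (pdGraph Ψ).Adj s (Sum.inl (i, c))) :
    ∃ a : Fin 6, s = Sum.inl (i, a) := by
  rcases s with ⟨j, a⟩ | ⟨⟨h, q⟩, hq⟩
  · simp only [pdGraph, SimpleGraph.fromRel_adj, pdRel] at hs
    obtain ⟨-, ⟨rfl, -⟩ | ⟨rfl, -⟩⟩ := hs <;> exact ⟨a, rfl⟩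
  · simp only [pdGraph, SimpleGraph.fromRel_adj, pdRel] at hs
    have hlit : c = if Ψ.eps h then 0 else 1 := by tauto
    split_ifs at hlit <;> subst hlit <;> exact absurd hc (by decide)

/-- Within a variable gadget, vertices whose positions differ modulo `3` are adjacent. -/
lemma pdGraph_adj_gadget {n m : ℕ} (Ψ : PMCnf n m) (i : Fin n) {a b : Fin 6}
    (hab : a.val % 3 ≠ b.val % 3) :
    (pdGraph Ψ).Adj (Sum.inl (i, a)) (Sum.inl (i, b)) := by
  refine (SimpleGraph.fromRel_adj _ _ _).2 ⟨?_, Or.inl ⟨rfl, hab⟩⟩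
  rintro h
  simp only [Sum.inl.injEq, Prod.mk.injEq, true_and] at h
  exact hab (by rw [h])

/-- A propagation step cannot reach the non-literal vertices of a gadget, since each literal
vertex sees both `u_i` and `u'_i`. -/
lemma nonliteral_notMem_pdStep {n m : ℕ} {Ψ : PMCnf n m} {i : Fin n} {A : Set (PVert Ψ)}
    (hA : ∀ c : Fin 6, 2 ≤ c → (Sum.inl (i, c) : PVert Ψ) ∉ A) (c : Fin 6) (hc : 2 ≤ c) :
    (Sum.inl (i, c) : PVert Ψ) ∉ pdStep (pdGraph Ψ) A := by
  rintro (h | h | ⟨s, ⟨hsA, huniq⟩, hadj⟩)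
  · exact hA c hc h
  · exact hA c hc h.1
  · obtain ⟨a, rfl⟩ := pdGraph_adj_nonliteral hc hadj.symm
    have ha : a.val < 2 := by
      by_contra! ha
      exact hA a ha hsA
    have heq := huniq.unique
      ⟨hA 2 (by decide), pdGraph_adj_gadget Ψ i (a := a) (b := 2) (by simp; omega)⟩
      ⟨hA 5 (by decide), pdGraph_adj_gadget Ψ i (a := a) (b := 5) (by simp; omega)⟩
    simp at heq

/-- Every power dominating set of `G'_Ψ` contains at least
one of the six vertices of each variable gadget. -/
theorem pdGraph_powerDominating_meets_gadget {n m : ℕ} (Ψ : PMCnf n m)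
    (hsz : ∀ h : Fin m, (Ψ.L h).card = 2 ∨ (Ψ.L h).card = 3)
    (S : Set (PVert Ψ)) (hS : IsPowerDominating (pdGraph Ψ) S) :
    ∀ i : Fin n, ∃ c : Fin 6, (Sum.inl (i, c) : PVert Ψ) ∈ S := by
  intro i
  by_contra! hi
  obtain ⟨k, hk⟩ := hS
  have hinit : ∀ c : Fin 6, 2 ≤ c → (Sum.inl (i, c) : PVert Ψ) ∉ closedNbhd (pdGraph Ψ) S := by
    rintro c hc (h | ⟨s, hsS, hadj⟩)
    · exact hi c h
    · obtain ⟨a, rfl⟩ := pdGraph_adj_nonliteral hc hadj.symm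
      exact hi a hsS
  have hiter : ∀ k : ℕ, ∀ c : Fin 6, 2 ≤ c →
      (Sum.inl (i, c) : PVert Ψ) ∉ (pdStep (pdGraph Ψ))^[k] (closedNbhd (pdGraph Ψ) S) := by
    intro k
    induction k with
    | zero => exact hinit
    | succ k ih =>
      rw [Function.iterate_succ_apply']
      exact nonliteral_notMem_pdStep ih
  exact hiter k 2 le_rfl (hk ▸ Set.mem_univ _)
end

section
/- Let Ψ be a planar-monotone-style CNF instance with n variables in which every clause has |L_h| ∈ {2,3}, let G'_Ψ be the associated power-domination graph, and let h be a clause with L_h = {i,j,k} of size 3. If S is a power dominating set of G'_Ψ, then S contains at least one of the six vertices w_i, w_j, w_k, z_{h,i}, z_{h,j}, z_{h,k} (where w_l is v_l or v̄_l according to the sign ε_h). -/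
/-- If `F` is a fort (every vertex outside `F` with a neighbor in `F` has a second one), then a
set disjoint from `F` remains disjoint from `F` under propagation. -/
theorem disjoint_pdStep_of_fort {V : Type*} {G : SimpleGraph V} {F A : Set V}
    (hF : ∀ s ∉ F, ∀ f ∈ F, G.Adj s f → ∃ g ∈ F, g ≠ f ∧ G.Adj s g)
    (hA : Disjoint A F) : Disjoint (pdStep G A) F := by
  rw [Set.disjoint_left] at hA ⊢
  rintro x (hx | hx | ⟨s, ⟨hsA, hs⟩, hadj⟩) hxF
  · exact hA hx hxF
  · exact hA hx.1 hxF
  · obtain ⟨g, hgF, hne, hg⟩ := hF s (hA hsA) x hxF hadj.symm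
    exact hne (hs.unique ⟨fun hgA => hA hgA hgF, hg⟩ ⟨fun hxA => hA hxA hxF, hadj.symm⟩)

/-- A power dominating set has a vertex in the closed neighborhood of every nonempty fort. -/
theorem IsPowerDominating.not_disjoint_fort {V : Type*} {G : SimpleGraph V} {S F : Set V}
    (hS : IsPowerDominating G S) (hne : F.Nonempty)
    (hF : ∀ s ∉ F, ∀ f ∈ F, G.Adj s f → ∃ g ∈ F, g ≠ f ∧ G.Adj s g) :
    ¬ Disjoint (closedNbhd G S) F := by
  intro hdisj
  obtain ⟨k, hk⟩ := hS
  have hiter : ∀ k, Disjoint ((pdStep G)^[k] (closedNbhd G S)) F := by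
    intro k
    induction k with
    | zero => exact hdisj
    | succ k ih =>
      rw [Function.iterate_succ_apply']
      exact disjoint_pdStep_of_fort hF ih
  specialize hiter k
  rw [hk, Set.univ_disjoint] at hiter
  exact hne.ne_empty hiter

theorem pdGraph_adj_wV_zV {n m : ℕ} {Ψ : PMCnf n m} {h : Fin m} {l l' : Fin n}
    (hl : l ∈ Ψ.L h) (hl' : l' ∈ Ψ.L h) (hne : l ≠ l') :
    (pdGraph Ψ).Adj (wV Ψ h l') (zV Ψ h l hl) := by
  simp [pdGraph, wV, zV, pdRel, hl', hne]

theorem eq_wV_or_zV_of_adj_zV {n m : ℕ} {Ψ : PMCnf n m} {h : Fin m}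
    (hcard : (Ψ.L h).card ≠ 2) {l : Fin n} (hl : l ∈ Ψ.L h) {x : PVert Ψ}
    (hx : (pdGraph Ψ).Adj x (zV Ψ h l hl)) :
    (∃ l' ∈ Ψ.L h, l ≠ l' ∧ x = wV Ψ h l') ∨ ∃ l', ∃ hl' : l' ∈ Ψ.L h, x = zV Ψ h l' hl' := by
  obtain ⟨a, b⟩ | ⟨⟨h', l' | q⟩, hq⟩ := x
  · left
    simp only [pdGraph, zV, SimpleGraph.fromRel_adj, pdRel, or_self] at hx
    obtain ⟨-, rfl, ha, hla⟩ := hx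
    exact ⟨a, ha, hla l rfl, rfl⟩
  · right
    simp only [pdGraph, zV, SimpleGraph.fromRel_adj, pdRel] at hx
    obtain rfl : h' = h := hx.2.elim (·.1) (·.1.symm)
    exact ⟨l', hq, rfl⟩
  · simp only [pdGraph, zV, SimpleGraph.fromRel_adj, pdRel] at hx
    obtain rfl : h' = h := hx.2.elim (·.1) (·.1.symm)
    exact absurd hq hcard


/-- For a clause `h` with `L h = {i, j, k}` of size three,
every power dominating set of `G'_Ψ` contains one of
`w_i, w_j, w_k, z_{h,i}, z_{h,j}, z_{h,k}`. -/
theorem pdGraph_powerDominating_meets_clause3 {n m : ℕ} (Ψ : PMCnf n m)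
    (hsz : ∀ h : Fin m, (Ψ.L h).card = 2 ∨ (Ψ.L h).card = 3)
    (h : Fin m) (i j k : Fin n) (hij : i ≠ j) (hik : i ≠ k) (hjk : j ≠ k)
    (hL : Ψ.L h = {i, j, k})
    (hi : i ∈ Ψ.L h) (hj : j ∈ Ψ.L h) (hk : k ∈ Ψ.L h)
    (S : Set (PVert Ψ)) (hS : IsPowerDominating (pdGraph Ψ) S) :
    wV Ψ h i ∈ S ∨ wV Ψ h j ∈ S ∨ wV Ψ h k ∈ S ∨
      zV Ψ h i hi ∈ S ∨ zV Ψ h j hj ∈ S ∨ zV Ψ h k hk ∈ S := by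
  have hcard : (Ψ.L h).card = 3 := by
    rw [hL]; exact Finset.card_eq_three.2 ⟨i, j, k, hij, hik, hjk, rfl⟩
  have hmem : ∀ l ∈ Ψ.L h, l = i ∨ l = j ∨ l = k := by simp [hL]
  let F : Set (PVert Ψ) := {x | ∃ l, ∃ hl : l ∈ Ψ.L h, x = zV Ψ h l hl}
  have hfort : ∀ s ∉ F, ∀ f ∈ F, (pdGraph Ψ).Adj s f →
      ∃ g ∈ F, g ≠ f ∧ (pdGraph Ψ).Adj s g := by
    rintro s hs _ ⟨l, hl, rfl⟩ hadj
    obtain ⟨l', hl', hne, rfl⟩ | hsF := eq_wV_or_zV_of_adj_zV (by omega) hl hadj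
    · obtain ⟨l'', hl'', hnot⟩ : ∃ l'' ∈ Ψ.L h, l'' ∉ ({l, l'} : Finset (Fin n)) :=
        Finset.exists_mem_notMem_of_card_lt_card (by rw [Finset.card_pair hne]; omega)
      simp only [Finset.mem_insert, Finset.mem_singleton, not_or] at hnot
      exact ⟨_, ⟨l'', hl'', rfl⟩, fun heq => hnot.1 (by simpa [zV, Subtype.ext_iff] using heq),
        pdGraph_adj_wV_zV hl'' hl' hnot.2⟩
    · exact absurd hsF hs
  obtain ⟨x, hxS, l, hl, rfl⟩ :=
    Set.not_disjoint_iff.1 (hS.not_disjoint_fort (F := F) ⟨_, i, hi, rfl⟩ hfort)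
  have hz : ∀ l, ∀ hl : l ∈ Ψ.L h, zV Ψ h l hl ∈ S →
      zV Ψ h i hi ∈ S ∨ zV Ψ h j hj ∈ S ∨ zV Ψ h k hk ∈ S := by
    intro l hl hlS
    obtain rfl | rfl | rfl := hmem l hl <;> simp [hlS]
  obtain hxS | ⟨s, hs, hadj⟩ := hxS
  · exact .inr (.inr (.inr (hz l hl hxS)))
  · obtain ⟨l', hl', -, rfl⟩ | ⟨l', hl', rfl⟩ :=
      eq_wV_or_zV_of_adj_zV (by omega) hl hadj.symm
    · obtain rfl | rfl | rfl := hmem l' hl' <;> simp [hs]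
    · exact .inr (.inr (.inr (hz l' hl' hs)))
end

section
/- Let Ψ be a planar-monotone-style CNF instance with n variables in which every clause has |L_h| ∈ {2,3}, let G'_Ψ be the associated power-domination graph, and let h be a clause with L_h = {i,j} of size 2. If S is a power dominating set of G'_Ψ, then S contains at least one of the six vertices w_i, w_j, z_{h,i}, z_{h,j}, z_{h,h}, v_{h,h} (where w_l is v_l or v̄_l according to the sign ε_h). -/
/-- Two distinct vertices with the same open neighborhood cannot both be missed by the closed
neighborhood of a power dominating set: neither is ever the unique unobserved neighbor of an
observed vertex. -/
theorem IsPowerDominating.mem_closedNbhd_of_twins {V : Type*} {G : SimpleGraph V} {S : Set V}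
    (hS : IsPowerDominating G S) {a b : V} (hab : a ≠ b) (htwin : ∀ s, G.Adj s a ↔ G.Adj s b) :
    a ∈ closedNbhd G S ∨ b ∈ closedNbhd G S := by
  by_contra! hnot
  obtain ⟨k, hk⟩ := hS
  have step : ∀ A : Set V, a ∉ A ∧ b ∉ A → a ∉ pdStep G A ∧ b ∉ pdStep G A := by
    rintro A ⟨ha, hb⟩
    have not_adj : ∀ s ∈ pdS1 G A, ¬ G.Adj s a := fun s hs hsa =>
      hab (hs.2.unique ⟨ha, hsa⟩ ⟨hb, (htwin s).1 hsa⟩)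
    refine ⟨?_, ?_⟩
    · rintro (h | h | ⟨s, hs, h⟩)
      exacts [ha h, ha h.1, not_adj s hs h.symm]
    · rintro (h | h | ⟨s, hs, h⟩)
      exacts [hb h, hb h.1, not_adj s hs ((htwin s).2 h.symm)]
  have key : ∀ k, a ∉ (pdStep G)^[k] (closedNbhd G S) ∧ b ∉ (pdStep G)^[k] (closedNbhd G S) := by
    intro k
    induction k with
    | zero => exact hnot
    | succ k ih =>
      rw [Function.iterate_succ_apply']
      exact step _ ih
  exact (key k).1 (hk ▸ Set.mem_univ a)

/-- The neighbors of `z_{h,h}` and of `v_{h,h}` are the `w_l` and the `z_{h,l}` with `l ∈ L h`. -/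
theorem pdGraph_adj_inr_inr_iff {n m : ℕ} (Ψ : PMCnf n m) (h : Fin m) (c : Fin 2)
    (hc : (Ψ.L h).card = 2) (s : PVert Ψ) :
    (pdGraph Ψ).Adj s (Sum.inr ⟨(h, Sum.inr c), hc⟩) ↔
      ∃ l, ∃ hl : l ∈ Ψ.L h, s = wV Ψ h l ∨ s = zV Ψ h l hl := by
  rcases s with ⟨l, a⟩ | ⟨⟨h', l | d⟩, hq⟩
  · simp only [pdGraph, SimpleGraph.fromRel_adj, pdRel, wV, zV]
    aesop
  · simp only [pdGraph, SimpleGraph.fromRel_adj, pdRel]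
    constructor
    · rintro ⟨-, ⟨rfl, -⟩ | ⟨rfl, -⟩⟩ <;> exact ⟨l, hq, Or.inr rfl⟩
    · rintro ⟨l', hl', h_eq | h_eq⟩ <;> cases h_eq
      exact ⟨nofun, Or.inl ⟨rfl, nofun, Or.inl rfl⟩⟩
  · simp only [pdGraph, SimpleGraph.fromRel_adj, pdRel]
    constructor
    · rintro ⟨-, ⟨-, -, h_left | h_left⟩ | ⟨-, -, h_left | h_left⟩⟩ <;> cases h_left
    · rintro ⟨l', hl', h_eq | h_eq⟩ <;> cases h_eq

/-- For a clause `h` with `L h = {i, j}` of size two, every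
power dominating set of `G'_Ψ` contains one of
`w_i, w_j, z_{h,i}, z_{h,j}, z_{h,h}, v_{h,h}`. -/
theorem pdGraph_powerDominating_meets_clause2 {n m : ℕ} (Ψ : PMCnf n m)
    (hsz : ∀ h : Fin m, (Ψ.L h).card = 2 ∨ (Ψ.L h).card = 3)
    (h : Fin m) (i j : Fin n) (hij : i ≠ j) (hL : Ψ.L h = {i, j})
    (hc : (Ψ.L h).card = 2) (hi : i ∈ Ψ.L h) (hj : j ∈ Ψ.L h)
    (S : Set (PVert Ψ)) (hS : IsPowerDominating (pdGraph Ψ) S) :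
    wV Ψ h i ∈ S ∨ wV Ψ h j ∈ S ∨ zV Ψ h i hi ∈ S ∨ zV Ψ h j hj ∈ S ∨
      zhhV Ψ h hc ∈ S ∨ vhhV Ψ h hc ∈ S := by
  have twin_ne : zhhV Ψ h hc ≠ vhhV Ψ h hc := nofun
  have mem_of_adj : ∀ s ∈ S,
      (∃ l, ∃ hl : l ∈ Ψ.L h, s = wV Ψ h l ∨ s = zV Ψ h l hl) →
        wV Ψ h i ∈ S ∨ wV Ψ h j ∈ S ∨ zV Ψ h i hi ∈ S ∨ zV Ψ h j hj ∈ S := by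
    rintro s hs ⟨l, hl, hsl⟩
    have hl' : l = i ∨ l = j := by simpa [hL] using hl
    rcases hl' with rfl | rfl <;> rcases hsl with rfl | rfl <;> tauto
  rcases hS.mem_closedNbhd_of_twins twin_ne fun s =>
      (pdGraph_adj_inr_inr_iff Ψ h 0 hc s).trans (pdGraph_adj_inr_inr_iff Ψ h 1 hc s).symm with
    (hz | ⟨s, hs, hadj⟩) | (hv | ⟨s, hs, hadj⟩)
  · tauto
  · have := mem_of_adj s hs ((pdGraph_adj_inr_inr_iff Ψ h 0 hc s).1 hadj.symm)
    tauto
  · tauto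
  · have := mem_of_adj s hs ((pdGraph_adj_inr_inr_iff Ψ h 1 hc s).1 hadj.symm)
    tauto
end
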